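/- arXiv:1304.8074 — 2 statements merged into one kernel-verified Lean document; each statement's English description precedes it below -/
import Mathlib

section
/- Elementary collapses preserve persistent homology: Let g be a filtration of the cellular chain complex, and let A ∈ S m and b ∈ S (m-1) be cells such that b is a free face of A (i.e. (∂A) b = 1 and (∂x) b = 0 for every x ∈ S m with x ≠ A) and g(A) = g(b). Then for every degree n and all i ≤ j, the degree-n persistent homology H_n^{i,j} of the filtered complex K is isomorphic as a ZMod 2-module to the degree-n persistent homology H_n^{i,j} of the reduced filtered complex K∖{A,b} (filtered by the restriction of g). -/
noncomputable section

open LinearMap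

variable (M M' : ℤ → Type) [∀ n, AddCommGroup (M n)] [∀ n, Module (ZMod 2) (M n)]
  [∀ n, AddCommGroup (M' n)] [∀ n, Module (ZMod 2) (M' n)]

/-- Cast along an equality of degrees. -/
def mcast {n m : ℤ} (h : n = m) : M n ≃ₗ[ZMod 2] M m := by cases h; exact LinearEquiv.refl _ _

theorem mcast_comm (f : ∀ n, M n →ₗ[ZMod 2] M' n) {n m : ℤ} (h : n = m) (z : M n) :
    f m (mcast M h z) = mcast M' h (f n z) := by cases h; rfl

variable (D : ∀ n : ℤ, M n →ₗ[ZMod 2] M (n-1)) (D' : ∀ n : ℤ, M' n →ₗ[ZMod 2] M' (n-1))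

/-- The cycles in degree `n`. -/
def cycles (n : ℤ) : Submodule (ZMod 2) (M n) := LinearMap.ker (D n)

/-- The boundaries in degree `n`. -/
def bdries (n : ℤ) : Submodule (ZMod 2) (M n) :=
  (LinearMap.range (D (n+1))).map (mcast M (show n+1-1 = n by ring)).toLinearMap

/-- The homology in degree `n` : cycles modulo boundaries. -/
abbrev homology (n : ℤ) : Type _ :=
  cycles M D n ⧸ (bdries M D n).comap (cycles M D n).subtype

variable {M M'}

/-- A chain map between two complexes of graded modules. -/
def IsChainMap (f : ∀ n, M n →ₗ[ZMod 2] M' n) : Prop :=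
  ∀ n : ℤ, (D' n).comp (f n) = (f (n-1)).comp (D n)

variable {D D'}

/-- The map induced on cycles by a chain map. -/
def cyclesMap {f : ∀ n, M n →ₗ[ZMod 2] M' n} (hf : IsChainMap D D' f) (n : ℤ) :
    cycles M D n →ₗ[ZMod 2] cycles M' D' n :=
  (f n).restrict (p := cycles M D n) (q := cycles M' D' n) (fun x hx => by
    have h := LinearMap.ext_iff.mp (hf n) x
    simp only [LinearMap.comp_apply] at h
    simp only [cycles, LinearMap.mem_ker] at hx ⊢
    rw [h, hx, map_zero])

/-- The map induced on homology by a chain map. -/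
def inducedHom {f : ∀ n, M n →ₗ[ZMod 2] M' n} (hf : IsChainMap D D' f) (n : ℤ) :
    homology M D n →ₗ[ZMod 2] homology M' D' n :=
  Submodule.mapQ _ _ (cyclesMap hf n) (by
    rintro ⟨x, hx⟩ hmem
    simp only [Submodule.mem_comap, Submodule.subtype_apply] at hmem ⊢
    obtain ⟨y, ⟨c, rfl⟩, rfl⟩ := hmem
    refine ⟨D' (n+1) (f (n+1) c), ⟨f (n+1) c, rfl⟩, ?_⟩
    show _ = (cyclesMap hf n ⟨_, hx⟩ : M' n)
    have : (cyclesMap hf n ⟨_, hx⟩ : M' n) = f n (mcast M (show n+1-1 = n by ring) (D (n+1) c)) := rfl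
    rw [this, mcast_comm (M := M) (M' := M') f]
    have h2 := LinearMap.ext_iff.mp (hf (n+1)) c
    simp only [LinearMap.comp_apply] at h2
    exact congrArg _ h2)


variable (S : ℤ → Type) (d : ∀ n : ℤ, (S n →₀ ZMod 2) →ₗ[ZMod 2] (S (n-1) →₀ ZMod 2))

/-- Chains of the restricted complex: finitely supported functions on the cells satisfying `P`. -/
abbrev rCh (P : ∀ n : ℤ, S n → Prop) (n : ℤ) : Type := {x : S n // P n x} →₀ ZMod 2

/-- The boundary of the restricted complex: extend by zero, take the boundary, delete the
coefficients at the cells not satisfying `P`. -/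
def resD (P : ∀ n : ℤ, S n → Prop) (n : ℤ) : rCh S P n →ₗ[ZMod 2] rCh S P (n-1) :=
  (Finsupp.lsubtypeDomain (R := ZMod 2) {x : S (n-1) | P (n-1) x}).comp
    ((d n).comp (Finsupp.lmapDomain (ZMod 2) (ZMod 2) Subtype.val))

/-- Deletion: restrict a chain to the cells satisfying `P`. -/
def delMap (P : ∀ n : ℤ, S n → Prop) (n : ℤ) : (S n →₀ ZMod 2) →ₗ[ZMod 2] rCh S P n :=
  Finsupp.lsubtypeDomain (R := ZMod 2) {x : S n | P n x}

/-- Inclusion: extend a chain on the cells satisfying `P` by zero. -/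
def inclMap (P : ∀ n : ℤ, S n → Prop) (n : ℤ) : rCh S P n →ₗ[ZMod 2] (S n →₀ ZMod 2) :=
  Finsupp.lmapDomain (ZMod 2) (ZMod 2) Subtype.val

/-- Inclusion between restricted complexes. -/
def resIncl {P Q : ∀ n : ℤ, S n → Prop} (h : ∀ n x, P n x → Q n x) (n : ℤ) :
    rCh S P n →ₗ[ZMod 2] rCh S Q n :=
  Finsupp.lmapDomain (ZMod 2) (ZMod 2) (fun x => ⟨x.1, h n x.1 x.2⟩)

/-- The cells different from the two given cells `A ∈ S m` and `b ∈ S (m-1)`. -/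
def offPair (m : ℤ) (A : S m) (b : S (m-1)) : ∀ n : ℤ, S n → Prop :=
  fun n x => (⟨n, x⟩ : Σ k, S k) ≠ ⟨m, A⟩ ∧ (⟨n, x⟩ : Σ k, S k) ≠ ⟨m - 1, b⟩


/-- The sublevel predicate of a filtration `g` at level `t`. -/
def subl (g : ∀ n : ℤ, S n → ℤ) (t : ℤ) : ∀ n : ℤ, S n → Prop := fun n x => g n x ≤ t

/-- Sublevel predicate of the reduced complex `K∖{A,b}` at level `t`. -/
def offSubl (m : ℤ) (A : S m) (b : S (m-1)) (g : ∀ n : ℤ, S n → ℤ) (t : ℤ) :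
    ∀ n : ℤ, S n → Prop := fun n x => offPair S m A b n x ∧ g n x ≤ t

end

section helpers

theorem aux_mem_bdries {M : ℤ → Type} [∀ n, AddCommGroup (M n)] [∀ n, Module (ZMod 2) (M n)]
    (D : ∀ n : ℤ, M n →ₗ[ZMod 2] M (n-1)) (n k : ℤ) (h : k - 1 = n) (x : M n) :
    x ∈ bdries M D n ↔ ∃ c : M k, mcast M h (D k c) = x := by
  obtain rfl : k = n + 1 := by omega
  simp [bdries, LinearEquiv.eq_symm_apply]

theorem aux_mem_bdries' {M : ℤ → Type} [∀ n, AddCommGroup (M n)] [∀ n, Module (ZMod 2) (M n)]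
    (D : ∀ n : ℤ, M n →ₗ[ZMod 2] M (n-1)) (k : ℤ) (x : M (k-1)) :
    x ∈ bdries M D (k-1) ↔ ∃ c : M k, D k c = x := by
  rw [aux_mem_bdries D (k-1) k rfl]
  rfl

theorem aux_incl_apply (S : ℤ → Type) (P : ∀ n : ℤ, S n → Prop) (n : ℤ) (z : rCh S P n)
    (x : S n) (hx : P n x) : inclMap S P n z x = z ⟨x, hx⟩ :=
  Finsupp.mapDomain_apply Subtype.val_injective z ⟨x, hx⟩

theorem aux_incl_ne (S : ℤ → Type) (P : ∀ n : ℤ, S n → Prop) (n : ℤ) (z : rCh S P n)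
    (x : S n) (hx : inclMap S P n z x ≠ 0) : P n x := by
  by_contra h
  apply hx
  apply Finsupp.mapDomain_of_notMem_range
  rintro ⟨y, rfl⟩
  exact h y.2

theorem aux_incl_inj (S : ℤ → Type) (P : ∀ n : ℤ, S n → Prop) (n : ℤ) :
    Function.Injective (inclMap S P n) :=
  Finsupp.mapDomain_injective Subtype.val_injective

theorem aux_incl_del (S : ℤ → Type) (P : ∀ n : ℤ, S n → Prop) (n : ℤ) (z : S n →₀ ZMod 2)
    (h : ∀ x, z x ≠ 0 → P n x) : inclMap S P n (delMap S P n z) = z := by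
  ext x
  by_cases hx : P n x
  · rw [aux_incl_apply S P n _ x hx]; rfl
  · have h1 : z x = 0 := by
      by_contra h2
      exact hx (h x h2)
    rw [h1]
    by_contra h2
    exact hx (aux_incl_ne S P n _ x h2)

theorem aux_incl_res (S : ℤ → Type) {P Q : ∀ n : ℤ, S n → Prop} (h : ∀ n x, P n x → Q n x)
    (n : ℤ) (z : rCh S P n) : inclMap S Q n (resIncl S h n z) = inclMap S P n z := by
  simp only [inclMap, resIncl, Finsupp.lmapDomain_apply]
  rw [← Finsupp.mapDomain_comp]
  rfl

/-- Closedness of a predicate on cells under taking boundaries. -/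
def auxClosed (S : ℤ → Type) (d : ∀ n : ℤ, (S n →₀ ZMod 2) →ₗ[ZMod 2] (S (n-1) →₀ ZMod 2))
    (P : ∀ n : ℤ, S n → Prop) : Prop :=
  ∀ (n : ℤ) (a : S n) (c : S (n-1)), P n a → (d n (Finsupp.single a 1)) c ≠ 0 → P (n-1) c

theorem aux_d_apply (S : ℤ → Type)
    (d : ∀ n : ℤ, (S n →₀ ZMod 2) →ₗ[ZMod 2] (S (n-1) →₀ ZMod 2)) (n : ℤ) (z : S n →₀ ZMod 2)
    (c : S (n-1)) : d n z c = z.sum (fun a r => r * d n (Finsupp.single a 1) c) := by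
  conv_lhs => rw [← Finsupp.sum_single z]
  rw [Finsupp.sum, map_sum, Finsupp.finsetSum_apply]
  apply Finset.sum_congr rfl
  intro a _
  rw [← Finsupp.smul_single_one, map_smul]
  rfl

theorem aux_closed_chain {S : ℤ → Type}
    {d : ∀ n : ℤ, (S n →₀ ZMod 2) →ₗ[ZMod 2] (S (n-1) →₀ ZMod 2)}
    {P : ∀ n : ℤ, S n → Prop} (hP : auxClosed S d P) (n : ℤ) (z : S n →₀ ZMod 2)
    (hz : ∀ x, z x ≠ 0 → P n x) (c : S (n-1)) (hc : d n z c ≠ 0) : P (n-1) c := by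
  rw [aux_d_apply] at hc
  obtain ⟨a, ha, h⟩ := Finset.exists_ne_zero_of_sum_ne_zero hc
  exact hP n a c (hz a (left_ne_zero_of_mul h)) (right_ne_zero_of_mul h)

theorem aux_incl_d {S : ℤ → Type}
    {d : ∀ n : ℤ, (S n →₀ ZMod 2) →ₗ[ZMod 2] (S (n-1) →₀ ZMod 2)}
    {P : ∀ n : ℤ, S n → Prop} (hP : auxClosed S d P) (n : ℤ) (z : rCh S P n) :
    inclMap S P (n-1) (resD S d P n z) = d n (inclMap S P n z) :=
  aux_incl_del S P (n-1) (d n (inclMap S P n z))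
    (aux_closed_chain hP n _ (aux_incl_ne S P n z))

theorem aux_chainMap {S : ℤ → Type}
    {d : ∀ n : ℤ, (S n →₀ ZMod 2) →ₗ[ZMod 2] (S (n-1) →₀ ZMod 2)}
    {P Q : ∀ n : ℤ, S n → Prop} (hP : auxClosed S d P) (hQ : auxClosed S d Q)
    (h : ∀ n x, P n x → Q n x) : IsChainMap (resD S d P) (resD S d Q) (resIncl S h) := by
  intro n
  apply LinearMap.ext
  intro z
  apply aux_incl_inj
  simp only [LinearMap.comp_apply]
  rw [aux_incl_d hQ, aux_incl_res, aux_incl_res, aux_incl_d hP]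

theorem aux_coef {S : ℤ → Type}
    {d : ∀ n : ℤ, (S n →₀ ZMod 2) →ₗ[ZMod 2] (S (n-1) →₀ ZMod 2)}
    {m : ℤ} {A : S m} {b : S (m-1)}
    (hAb : (d m (Finsupp.single A 1)) b = 1)
    (hfree : ∀ x : S m, x ≠ A → (d m (Finsupp.single x 1)) b = 0) (w : S m →₀ ZMod 2) :
    d m w b = w A := by
  rw [aux_d_apply, Finsupp.sum, Finset.sum_eq_single A]
  · rw [hAb, mul_one]
  · intro x _ hx
    rw [hfree x hx, mul_zero]
  · intro h
    rw [Finsupp.notMem_support_iff.mp h, zero_mul]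

theorem aux_closed_off {S : ℤ → Type}
    {d : ∀ n : ℤ, (S n →₀ ZMod 2) →ₗ[ZMod 2] (S (n-1) →₀ ZMod 2)}
    (hd : ∀ n : ℤ, (d (n-1)).comp (d n) = 0)
    {g : ∀ n : ℤ, S n → ℤ}
    (hg : ∀ (n : ℤ) (a : S n) (c : S (n-1)),
      (d n (Finsupp.single a 1)) c ≠ 0 → g (n-1) c ≤ g n a)
    {m : ℤ} {A : S m} {b : S (m-1)}
    (hAb : (d m (Finsupp.single A 1)) b = 1)
    (hfree : ∀ x : S m, x ≠ A → (d m (Finsupp.single x 1)) b = 0) (t : ℤ) :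
    auxClosed S d (offSubl S m A b g t) := by
  rintro n a c ⟨⟨h1, h2⟩, h3⟩ hc
  refine ⟨⟨?_, ?_⟩, (hg n a c hc).trans h3⟩
  · intro h
    obtain ⟨rfl, h⟩ := Sigma.mk.inj h
    obtain rfl := eq_of_heq h
    apply hc
    rw [← aux_coef hAb hfree]
    have := LinearMap.congr_fun (hd n) (Finsupp.single a 1)
    rw [LinearMap.comp_apply] at this
    rw [this]
    rfl
  · intro h
    obtain ⟨h', h⟩ := Sigma.mk.inj h
    obtain rfl : n = m := by omega
    obtain rfl := eq_of_heq h
    apply hc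
    apply hfree
    rintro rfl
    exact h1 rfl

theorem aux_key {S : ℤ → Type}
    {d : ∀ n : ℤ, (S n →₀ ZMod 2) →ₗ[ZMod 2] (S (n-1) →₀ ZMod 2)}
    {g : ∀ n : ℤ, S n → ℤ}
    (hg : ∀ (n : ℤ) (a : S n) (c : S (n-1)),
      (d n (Finsupp.single a 1)) c ≠ 0 → g (n-1) c ≤ g n a)
    {m : ℤ} {A : S m} {b : S (m-1)}
    (hAb : (d m (Finsupp.single A 1)) b = 1)
    (hgAb : g m A = g (m-1) b) (t k : ℤ) (z : S (k-1) →₀ ZMod 2)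
    (hz : ∀ x, z x ≠ 0 → g (k-1) x ≤ t)
    (hzA : ∀ x, (⟨k-1, x⟩ : Σ k, S k) = ⟨m, A⟩ → z x = 0) :
    ∃ c : S k →₀ ZMod 2, (∀ x, c x ≠ 0 → g k x ≤ t) ∧
      ∀ x, (z - d k c) x ≠ 0 → offSubl S m A b g t (k-1) x := by
  by_cases hk : k = m
  · subst hk
    have hc : ∀ x, (Finsupp.single A (z b)) x ≠ 0 → g k x ≤ t := by
      intro x hx
      obtain ⟨rfl, h⟩ := Finsupp.single_apply_ne_zero.mp hx
      rw [hgAb]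
      exact hz b h
    have hcl : auxClosed S d (subl S g t) := fun n a c h1 h2 => (hg n a c h2).trans h1
    refine ⟨Finsupp.single A (z b), hc, fun x hx => ⟨⟨?_, ?_⟩, ?_⟩⟩
    · intro h
      have := (Sigma.mk.inj h).1
      omega
    · intro h
      obtain rfl := eq_of_heq (Sigma.mk.inj h).2
      apply hx
      rw [← Finsupp.smul_single_one, map_smul]
      simp [hAb]
    · by_cases h : z x = 0
      · apply aux_closed_chain hcl k _ hc x
        intro h'
        apply hx
        simp [h, h']
      · exact hz x h
  · refine ⟨0, by simp, fun x hx => ⟨⟨?_, ?_⟩, ?_⟩⟩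
    · intro h
      apply hx
      simpa using hzA x h
    · intro h
      have := (Sigma.mk.inj h).1
      omega
    · apply hz
      simpa using hx

theorem aux_bij {S : ℤ → Type}
    {d : ∀ n : ℤ, (S n →₀ ZMod 2) →ₗ[ZMod 2] (S (n-1) →₀ ZMod 2)}
    (hd : ∀ n : ℤ, (d (n-1)).comp (d n) = 0)
    {g : ∀ n : ℤ, S n → ℤ}
    (hg : ∀ (n : ℤ) (a : S n) (c : S (n-1)),
      (d n (Finsupp.single a 1)) c ≠ 0 → g (n-1) c ≤ g n a)
    {m : ℤ} {A : S m} {b : S (m-1)}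
    (hAb : (d m (Finsupp.single A 1)) b = 1)
    (hfree : ∀ x : S m, x ≠ A → (d m (Finsupp.single x 1)) b = 0)
    (hgAb : g m A = g (m-1) b) (t : ℤ)
    (hι : IsChainMap (resD S d (offSubl S m A b g t)) (resD S d (subl S g t))
      (resIncl S (fun _ _ hx => hx.2))) (n : ℤ) :
    Function.Bijective (inducedHom hι n) := by
  have hcl : auxClosed S d (subl S g t) := fun n a c h1 h2 => (hg n a c h2).trans h1
  have hcl' := aux_closed_off hd hg hAb hfree t
  have hdd : ∀ k (c : S k →₀ ZMod 2), d (k-1) (d k c) = 0 := fun k c =>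
    LinearMap.congr_fun (hd k) c
  obtain ⟨k, rfl⟩ : ∃ k, n = k - 1 := ⟨n + 1, by ring⟩
  constructor
  · rw [injective_iff_map_eq_zero]
    intro q hq
    obtain ⟨⟨w, hw⟩, rfl⟩ := Submodule.Quotient.mk_surjective _ q
    rw [Submodule.Quotient.mk_eq_zero]
    have hq2 := (Submodule.Quotient.mk_eq_zero _).mp hq
    rw [Submodule.mem_comap] at hq2 ⊢
    obtain ⟨c, hc⟩ := (aux_mem_bdries' _ k _).mp hq2
    have hc2 : d k (inclMap S _ k c) = inclMap S _ (k-1) w := by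
      rw [← aux_incl_d hcl, hc]
      exact aux_incl_res S (P := offSubl S m A b g t) (Q := subl S g t) (fun _ _ hx => hx.2) _ w
    obtain ⟨l, rfl⟩ : ∃ l, k = l - 1 := ⟨k + 1, by ring⟩
    obtain ⟨e, he1, he2⟩ := aux_key hg hAb hgAb t l (inclMap S _ (l-1) c)
      (aux_incl_ne S _ _ c) (by
        intro x h
        obtain ⟨rfl, h⟩ := Sigma.mk.inj h
        obtain rfl := eq_of_heq h
        rw [← aux_coef hAb hfree, hc2]
        by_contra h'
        exact (aux_incl_ne S _ _ w _ h').1.2 rfl)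
    refine (aux_mem_bdries' _ (l-1) _).mpr ⟨delMap S _ (l-1)
      (inclMap S _ (l-1) c - d l e), ?_⟩
    · apply aux_incl_inj
      rw [aux_incl_d hcl', aux_incl_del _ _ _ _ he2, map_sub, hdd, sub_zero, hc2]
      rfl
  · intro q
    obtain ⟨⟨z, hz⟩, rfl⟩ := Submodule.Quotient.mk_surjective _ q
    have hz' : d (k-1) (inclMap S _ (k-1) z) = 0 := by
      rw [← aux_incl_d hcl, LinearMap.mem_ker.mp hz, map_zero]
    obtain ⟨c, hc1, hc2⟩ := aux_key hg hAb hgAb t k (inclMap S _ (k-1) z)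
      (aux_incl_ne S _ _ z) (by
        intro x h
        obtain ⟨rfl, h⟩ := Sigma.mk.inj h
        obtain rfl := eq_of_heq h
        rw [← aux_coef hAb hfree, hz']
        rfl)
    refine ⟨Submodule.Quotient.mk ⟨delMap S _ (k-1) (inclMap S _ (k-1) z - d k c), ?_⟩, ?_⟩
    · apply LinearMap.mem_ker.mpr
      apply aux_incl_inj
      rw [aux_incl_d hcl', aux_incl_del _ _ _ _ hc2, map_sub, hdd, hz', sub_zero, map_zero]
    · refine (Submodule.Quotient.eq _).mpr ?_
      rw [Submodule.mem_comap]
      refine (aux_mem_bdries' _ k _).mpr ⟨- delMap S _ k c, ?_⟩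
      apply aux_incl_inj
      rw [aux_incl_d hcl, map_neg, aux_incl_del _ _ _ _ hc1]
      have e1 : ∀ n x, offSubl S m A b g t n x → subl S g t n x := fun _ _ hx => hx.2
      change _ = inclMap S _ (k-1) (resIncl S e1 (k-1)
        (delMap S _ (k-1) (inclMap S _ (k-1) z - d k c)) - z)
      rw [map_sub, aux_incl_res, aux_incl_del _ _ _ _ hc2, map_neg]
      abel

theorem aux_range {V W V' W' : Type} [AddCommGroup V] [Module (ZMod 2) V]
    [AddCommGroup W] [Module (ZMod 2) W] [AddCommGroup V'] [Module (ZMod 2) V']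
    [AddCommGroup W'] [Module (ZMod 2) W'] (f : V →ₗ[ZMod 2] W) (f' : V' →ₗ[ZMod 2] W')
    (p : V' →ₗ[ZMod 2] V) (q : W' →ₗ[ZMod 2] W) (hp : Function.Bijective p)
    (hq : Function.Bijective q) (h : ∀ x, f (p x) = q (f' x)) :
    Nonempty (LinearMap.range f ≃ₗ[ZMod 2] LinearMap.range f') := by
  have h1 : LinearMap.range f = (LinearMap.range f').map q := by
    ext y
    constructor
    · rintro ⟨x, rfl⟩
      obtain ⟨x, rfl⟩ := hp.2 x
      exact ⟨f' x, ⟨x, rfl⟩, (h x).symm⟩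
    · rintro ⟨_, ⟨x, rfl⟩, rfl⟩
      exact ⟨p x, h x⟩
  rw [h1]
  exact ⟨(Submodule.equivMapOfInjective q hq.1 _).symm⟩

end helpers

/-- Elementary collapses preserve persistent homology: if `b` is a free face of `A` in every
sublevel complex (equivalently, in `K`) and `g A = g b`, then the persistent homology of the
filtered complex `K` agrees with that of the reduced filtered complex `K∖{A,b}` in every degree. -/
theorem elementary_collapse_persistence
    (S : ℤ → Type)
    (d : ∀ n : ℤ, (S n →₀ ZMod 2) →ₗ[ZMod 2] (S (n-1) →₀ ZMod 2))
    (hd : ∀ n : ℤ, (d (n-1)).comp (d n) = 0)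
    (g : ∀ n : ℤ, S n → ℤ)
    (hg : ∀ (n : ℤ) (a : S n) (c : S (n-1)),
      (d n (Finsupp.single a 1)) c ≠ 0 → g (n-1) c ≤ g n a)
    (m : ℤ) (A : S m) (b : S (m-1))
    (hAb : (d m (Finsupp.single A 1)) b = 1)
    (hfree : ∀ x : S m, x ≠ A → (d m (Finsupp.single x 1)) b = 0)
    (hgAb : g m A = g (m-1) b) :
    ∃ (hK : ∀ (i j : ℤ) (hij : i ≤ j),
        IsChainMap (resD S d (subl S g i)) (resD S d (subl S g j))
          (resIncl S (P := subl S g i) (Q := subl S g j) (fun _ _ hx => le_trans hx hij)))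
      (hR : ∀ (i j : ℤ) (hij : i ≤ j),
        IsChainMap (resD S d (offSubl S m A b g i)) (resD S d (offSubl S m A b g j))
          (resIncl S (P := offSubl S m A b g i) (Q := offSubl S m A b g j)
            (fun _ _ hx => ⟨hx.1, le_trans hx.2 hij⟩))),
      ∀ (n i j : ℤ) (hij : i ≤ j),
        Nonempty ((LinearMap.range (inducedHom (hK i j hij) n)) ≃ₗ[ZMod 2]
          (LinearMap.range (inducedHom (hR i j hij) n))) := by
  have hcl : ∀ t, auxClosed S d (subl S g t) := fun t n a c h1 h2 => (hg n a c h2).trans h1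
  have hcl' := aux_closed_off hd hg hAb hfree
  have hι := fun t => aux_chainMap (hcl' t) (hcl t) (fun _ _ hx => hx.2)
  refine ⟨fun i j hij => aux_chainMap (hcl i) (hcl j) _,
    fun i j hij => aux_chainMap (hcl' i) (hcl' j) _, fun n i j hij => ?_⟩
  refine aux_range _ _ (inducedHom (hι i) n) (inducedHom (hι j) n)
    (aux_bij hd hg hAb hfree hgAb i (hι i) n) (aux_bij hd hg hAb hfree hgAb j (hι j) n) ?_
  intro q
  obtain ⟨w, rfl⟩ := Submodule.Quotient.mk_surjective _ q
  refine congrArg Submodule.Quotient.mk (Subtype.ext ?_)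
  apply aux_incl_inj
  have e1 : ∀ n x, offSubl S m A b g i n x → subl S g i n x := fun _ _ hx => hx.2
  have e2 : ∀ n x, offSubl S m A b g j n x → subl S g j n x := fun _ _ hx => hx.2
  have e3 : ∀ n x, subl S g i n x → subl S g j n x := fun _ _ hx => le_trans hx hij
  have e4 : ∀ n x, offSubl S m A b g i n x → offSubl S m A b g j n x :=
    fun _ _ hx => ⟨hx.1, le_trans hx.2 hij⟩
  change inclMap S _ n (resIncl S e3 n (resIncl S e1 n w.1)) =
    inclMap S _ n (resIncl S e2 n (resIncl S e4 n w.1))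
  simp only [aux_incl_res]
end

section
/- Let T be a closed subset of the cells of a cellular chain complex such that the subcomplex C_T has trivial homology in every degree n ≥ 1 and the map induced on degree-0 homology by the inclusion C_T → C is injective. Then the deletion chain map from the cellular chain complex to the complement complex on S∖T induces an isomorphism on homology in every degree n ≥ 1. -/
theorem mem_bdries_iff' {M : ℤ → Type} [∀ n, AddCommGroup (M n)] [∀ n, Module (ZMod 2) (M n)]
    (D : ∀ n : ℤ, M n →ₗ[ZMod 2] M (n-1)) (m n : ℤ) (h : m - 1 = n) (x : M n) :
    x ∈ bdries M D n ↔ ∃ c : M m, mcast M h (D m c) = x := by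
  obtain rfl : m = n + 1 := by omega
  constructor
  · rintro ⟨y, ⟨c, rfl⟩, rfl⟩
    exact ⟨c, rfl⟩
  · rintro ⟨c, rfl⟩
    exact ⟨_, ⟨c, rfl⟩, rfl⟩

theorem mem_bdries_pred {M : ℤ → Type} [∀ n, AddCommGroup (M n)] [∀ n, Module (ZMod 2) (M n)]
    (D : ∀ n : ℤ, M n →ₗ[ZMod 2] M (n-1)) (m : ℤ) (x : M (m-1)) :
    x ∈ bdries M D (m-1) ↔ ∃ c : M m, D m c = x :=
  mem_bdries_iff' D m (m-1) rfl x

theorem hmk_eq_zero {M : ℤ → Type} [∀ n, AddCommGroup (M n)] [∀ n, Module (ZMod 2) (M n)]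
    {D : ∀ n : ℤ, M n →ₗ[ZMod 2] M (n-1)} {n : ℤ} (x : cycles M D n)
    (h : (Submodule.Quotient.mk x : homology M D n) = 0) : x.1 ∈ bdries M D n := by
  have h2 := (Submodule.Quotient.mk_eq_zero _).1 h
  exact h2

theorem inducedHom_inj_iff {M M' : ℤ → Type} [∀ n, AddCommGroup (M n)] [∀ n, Module (ZMod 2) (M n)]
    [∀ n, AddCommGroup (M' n)] [∀ n, Module (ZMod 2) (M' n)]
    {D : ∀ n : ℤ, M n →ₗ[ZMod 2] M (n-1)} {D' : ∀ n : ℤ, M' n →ₗ[ZMod 2] M' (n-1)}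
    {f : ∀ n, M n →ₗ[ZMod 2] M' n} (hf : IsChainMap D D' f) (n : ℤ) :
    Function.Injective (inducedHom hf n) ↔
      ∀ x, D n x = 0 → f n x ∈ bdries M' D' n → x ∈ bdries M D n := by
  rw [injective_iff_map_eq_zero]
  constructor
  · intro h x hx hfx
    have := h (Submodule.Quotient.mk ⟨x, hx⟩) (by
      refine (Submodule.Quotient.mk_eq_zero _).2 ?_
      exact hfx)
    exact hmk_eq_zero _ this
  · intro h q hq
    obtain ⟨⟨x, hx⟩, rfl⟩ := Submodule.Quotient.mk_surjective _ q
    refine (Submodule.Quotient.mk_eq_zero _).2 ?_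
    exact h x hx (hmk_eq_zero (cyclesMap hf n ⟨x, hx⟩) hq)

theorem les_aux {A B C : ℤ → Type} [∀ n, AddCommGroup (A n)] [∀ n, Module (ZMod 2) (A n)]
    [∀ n, AddCommGroup (B n)] [∀ n, Module (ZMod 2) (B n)]
    [∀ n, AddCommGroup (C n)] [∀ n, Module (ZMod 2) (C n)]
    {DA : ∀ n : ℤ, A n →ₗ[ZMod 2] A (n-1)} {DB : ∀ n : ℤ, B n →ₗ[ZMod 2] B (n-1)}
    {DC : ∀ n : ℤ, C n →ₗ[ZMod 2] C (n-1)}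
    {i : ∀ n, A n →ₗ[ZMod 2] B n} {p : ∀ n, B n →ₗ[ZMod 2] C n}
    (hi : IsChainMap DA DB i) (hp : IsChainMap DB DC p)
    (hd : ∀ n x, DB (n-1) (DB n x) = 0)
    (hii : ∀ n, Function.Injective (i n)) (hps : ∀ n, Function.Surjective (p n))
    (hpi : ∀ n a, p n (i n a) = 0)
    (hex : ∀ n b, p n b = 0 → ∃ a, i n a = b)
    (hac : ∀ n : ℤ, 1 ≤ n → Subsingleton (homology A DA n))
    (hinj : Function.Injective (inducedHom hi 0)) (n : ℤ) (hn : 1 ≤ n) :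
    Function.Bijective (inducedHom hp n) := by
  have hi' : ∀ n a, DB n (i n a) = i (n-1) (DA n a) := fun n a => LinearMap.congr_fun (hi n) a
  have hp' : ∀ n a, DC n (p n a) = p (n-1) (DB n a) := fun n a => LinearMap.congr_fun (hp n) a
  have key : ∀ k : ℤ, 1 ≤ k → ∀ a, DA k a = 0 → a ∈ bdries A DA k := by
    intro k hk a ha
    have := hac k hk
    exact hmk_eq_zero ⟨a, ha⟩
      (Subsingleton.elim (Submodule.Quotient.mk ⟨a, ha⟩ : homology A DA k) 0)
  have key0 : ∀ k : ℤ, 0 ≤ k → ∀ a, DA k a = 0 → i k a ∈ bdries B DB k → a ∈ bdries A DA k := by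
    intro k hk a ha hb
    rcases hk.eq_or_lt with rfl | hk
    · exact (inducedHom_inj_iff hi 0).1 hinj a ha hb
    · exact key k hk a ha
  constructor
  · obtain ⟨m, rfl⟩ : ∃ m, n = m - 1 := ⟨n + 1, by ring⟩
    rw [inducedHom_inj_iff]
    intro b hb hpb
    obtain ⟨c, hc⟩ := (mem_bdries_pred DC m _).1 hpb
    obtain ⟨b', rfl⟩ := hps m c
    rw [hp'] at hc
    obtain ⟨a, ha⟩ := hex _ (b - DB m b') (by rw [map_sub, hc, sub_self])
    have ha0 : DA _ a = 0 := by
      apply hii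
      rw [← hi', ha, map_sub, hb, hd, map_zero, sub_self]
    obtain ⟨a', rfl⟩ := (mem_bdries_pred DA m _).1 (key _ hn a ha0)
    refine (mem_bdries_pred DB m _).2 ⟨b' + i m a', ?_⟩
    rw [map_add, hi', ha]; abel
  · intro q
    obtain ⟨⟨z, hz⟩, rfl⟩ := Submodule.Quotient.mk_surjective _ q
    obtain ⟨b, rfl⟩ := hps n z
    have hz' : DC n (p n b) = 0 := hz
    rw [hp'] at hz'
    obtain ⟨a, ha⟩ := hex _ _ hz'
    have ha0 : DA _ a = 0 := by
      apply hii
      rw [← hi', ha, hd, map_zero]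
    obtain ⟨a', rfl⟩ := (mem_bdries_pred DA n _).1
      (key0 (n-1) (by omega) a ha0 ((mem_bdries_pred DB n _).2 ⟨b, ha.symm⟩))
    refine ⟨Submodule.Quotient.mk ⟨b - i n a', ?_⟩, ?_⟩
    · show DB n _ = 0
      rw [map_sub, hi', ha, sub_self]
    · refine congrArg Submodule.Quotient.mk (Subtype.ext ?_)
      show p n (b - i n a') = p n b
      rw [map_sub, hpi, sub_zero]

theorem inclMap_apply_mem (S : ℤ → Type) (P : ∀ n : ℤ, S n → Prop) (n : ℤ) (a : rCh S P n)
    (x : S n) (hx : P n x) : inclMap S P n a x = a ⟨x, hx⟩ :=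
  Finsupp.mapDomain_apply Subtype.val_injective a ⟨x, hx⟩

theorem inclMap_apply_not (S : ℤ → Type) (P : ∀ n : ℤ, S n → Prop) (n : ℤ) (a : rCh S P n)
    (x : S n) (hx : ¬ P n x) : inclMap S P n a x = 0 :=
  Finsupp.mapDomain_of_notMem_range a x (by rintro ⟨y, rfl⟩; exact hx y.2)

theorem delMap_apply (S : ℤ → Type) (P : ∀ n : ℤ, S n → Prop) (n : ℤ) (b : S n →₀ ZMod 2)
    (x : {x : S n // P n x}) : delMap S P n b x = b x.1 := rfl

theorem resD_apply (S : ℤ → Type) (d : ∀ n : ℤ, (S n →₀ ZMod 2) →ₗ[ZMod 2] (S (n-1) →₀ ZMod 2))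
    (P : ∀ n : ℤ, S n → Prop) (n : ℤ) (a : rCh S P n) :
    resD S d P n a = delMap S P (n-1) (d n (inclMap S P n a)) := rfl

theorem closed_aux (S : ℤ → Type)
    (d : ∀ n : ℤ, (S n →₀ ZMod 2) →ₗ[ZMod 2] (S (n-1) →₀ ZMod 2))
    (T : ∀ n : ℤ, S n → Prop)
    (hT : ∀ (n : ℤ) (t : S n), T n t →
      ∀ c : S (n-1), (d n (Finsupp.single t 1)) c ≠ 0 → T (n-1) c)
    (n : ℤ) (a : rCh S T n) (c : S (n-1)) (hc : ¬ T (n-1) c) : d n (inclMap S T n a) c = 0 := by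
  induction a using Finsupp.induction_linear with
  | zero => simp
  | add f g hf hg => rw [map_add, map_add, Finsupp.add_apply, hf, hg, add_zero]
  | single t r =>
    have h1 : inclMap S T n (Finsupp.single t r) = r • Finsupp.single t.1 1 := by
      simp [inclMap, Finsupp.mapDomain_single]
    rw [h1, map_smul, Finsupp.smul_apply]
    by_cases h : d n (Finsupp.single t.1 1) c = 0
    · rw [h, smul_zero]
    · exact absurd (hT n t.1 t.2 c h) hc

/-- If `T` is closed, the subcomplex `C_T` has trivial homology in every degree `n ≥ 1` and the
map induced on degree-0 homology by the inclusion `C_T → C` is injective, then the deletion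
chain map to the complement complex on `S∖T` induces an isomorphism on homology in every degree
`n ≥ 1`. -/
theorem acyclic_closed_subcomplex_deletion_pos_degrees
    (S : ℤ → Type)
    (d : ∀ n : ℤ, (S n →₀ ZMod 2) →ₗ[ZMod 2] (S (n-1) →₀ ZMod 2))
    (hd : ∀ n : ℤ, (d (n-1)).comp (d n) = 0)
    (T : ∀ n : ℤ, S n → Prop)
    (hT : ∀ (n : ℤ) (t : S n), T n t →
      ∀ c : S (n-1), (d n (Finsupp.single t 1)) c ≠ 0 → T (n-1) c)
    (hacyclic : ∀ n : ℤ, 1 ≤ n → Subsingleton (homology _ (resD S d T) n))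
    (hinj : ∀ hcm : IsChainMap (resD S d T) d (inclMap S T),
      Function.Injective (inducedHom hcm 0)) :
    ∃ hcm : IsChainMap d (resD S d (fun k x => ¬ T k x)) (delMap S (fun k x => ¬ T k x)),
      ∀ n : ℤ, 1 ≤ n → Function.Bijective (inducedHom hcm n) := by
  have hex : ∀ n b, delMap S (fun k x => ¬ T k x) n b = 0 →
      inclMap S T n (delMap S T n b) = b := by
    intro n b hb
    ext x
    by_cases hx : T n x
    · rw [inclMap_apply_mem S T n _ x hx]; rfl
    · rw [inclMap_apply_not S T n _ x hx]
      exact (DFunLike.congr_fun hb ⟨x, hx⟩).symm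
  have hpi : ∀ n a, delMap S (fun k x => ¬ T k x) n (inclMap S T n a) = 0 := by
    intro n a
    ext x
    exact inclMap_apply_not S T n a x.1 x.2
  have hpj : ∀ (P : ∀ n : ℤ, S n → Prop) n a, delMap S P n (inclMap S P n a) = a := by
    intro P n a
    ext x
    exact inclMap_apply_mem S P n a x.1 x.2
  have hcl : ∀ n a, delMap S (fun k x => ¬ T k x) (n-1) (d n (inclMap S T n a)) = 0 := by
    intro n a
    ext x
    exact closed_aux S d T hT n a x.1 x.2
  have hi : IsChainMap (resD S d T) d (inclMap S T) := by
    intro n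
    refine LinearMap.ext fun a => ?_
    exact (hex _ _ (hcl n a)).symm
  have hp : IsChainMap d (resD S d (fun k x => ¬ T k x)) (delMap S (fun k x => ¬ T k x)) := by
    intro n
    refine LinearMap.ext fun b => ?_
    rw [LinearMap.comp_apply, LinearMap.comp_apply, resD_apply, ← sub_eq_zero, ← map_sub, ← map_sub]
    set b' := inclMap S (fun k x => ¬ T k x) n (delMap S (fun k x => ¬ T k x) n b) - b with hb'
    rw [← hex n b' (by rw [hb', map_sub, hpj, sub_self])]
    exact hcl n _
  refine ⟨hp, fun n hn => les_aux hi hp (fun n x => LinearMap.congr_fun (hd n) x) ?_ ?_ hpi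
    (fun n b h => ⟨_, hex n b h⟩) hacyclic (hinj hi) n hn⟩
  · exact fun n => Function.LeftInverse.injective (hpj T n)
  · exact fun n => Function.RightInverse.surjective (hpj _ n)
end
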